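/- arXiv:1408.4133 — 6 statements merged into one kernel-verified Lean document; each statement's English description precedes it below -/
import Mathlib

section
/- For every finite sequence σ of natural numbers there exists a finite sequence of commutations transforming σ into a sequence τ that is in sawtooth form; in particular the entries of τ form the same multiset as the entries of σ (so τ has the same number of entries equal to any given value as σ does). -/
/-- A finite sequence of natural numbers is in sawtooth form if whenever an entry
is less than the next one, the next one is exactly one more. -/
def Sawtooth (σ : List ℕ) : Prop :=
  ∀ i : ℕ, i + 1 < σ.length →
    σ.getD i 0 < σ.getD (i + 1) 0 → σ.getD (i + 1) 0 = σ.getD i 0 + 1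

/-- A commutation swaps two adjacent entries whose values differ by more than 1. -/
def Commutation (σ τ : List ℕ) : Prop :=
  ∃ (l r : List ℕ) (x y : ℕ),
    (x + 1 < y ∨ y + 1 < x) ∧ σ = l ++ x :: y :: r ∧ τ = l ++ y :: x :: r

theorem Sawtooth.of_isChain {σ : List ℕ} (h : σ.IsChain fun a b => b ≤ a + 1) :
    Sawtooth σ := by
  intro i hi hlt
  have hle := List.isChain_iff_getElem.mp h i hi
  simp only [List.getD_eq_getElem _ _ hi, List.getD_eq_getElem _ _ (Nat.lt_of_succ_lt hi)]
    at hlt ⊢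
  omega

theorem Commutation.cons {σ τ : List ℕ} (a : ℕ) (h : Commutation σ τ) :
    Commutation (a :: σ) (a :: τ) := by
  obtain ⟨l, r, x, y, hxy, rfl, rfl⟩ := h
  exact ⟨a :: l, r, x, y, hxy, rfl, rfl⟩

theorem Commutation.perm {σ τ : List ℕ} (h : Commutation σ τ) : σ.Perm τ := by
  obtain ⟨l, r, x, y, -, rfl, rfl⟩ := h
  exact (List.Perm.swap y x r).append_left l

theorem perm_of_reflTransGen_commutation {σ τ : List ℕ}
    (h : Relation.ReflTransGen Commutation σ τ) : σ.Perm τ := by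
  induction h with
  | refl => exact .refl _
  | tail _ hc ih => exact ih.trans hc.perm

/-- An entry placed in front of a sawtooth sequence can be commuted into place. The last
clause allows the result to be extended on the left. -/
theorem exists_isChain_of_cons (x : ℕ) (σ : List ℕ) (h : σ.IsChain fun a b => b ≤ a + 1) :
    ∃ τ : List ℕ, Relation.ReflTransGen Commutation (x :: σ) τ ∧
      (τ.IsChain fun a b => b ≤ a + 1) ∧
      ∀ y, x ≤ y + 1 → ((y :: σ).IsChain fun a b => b ≤ a + 1) →
        (y :: τ).IsChain fun a b => b ≤ a + 1 := by
  induction σ with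
  | nil => exact ⟨[x], .refl, .singleton x, fun y hy _ => by simpa using hy⟩
  | cons z σ ih =>
    by_cases hz : z ≤ x + 1
    · have hx : (x :: z :: σ).IsChain fun a b => b ≤ a + 1 := .cons_cons hz h
      exact ⟨x :: z :: σ, .refl, hx, fun y hy _ => .cons_cons hy hx⟩
    · obtain ⟨τ, hτ, -, hext⟩ := ih h.tail
      have hzτ := hext z (by omega) h
      refine ⟨z :: τ, .head ⟨[], σ, x, z, .inl (by omega), rfl, rfl⟩
        (hτ.lift (z :: ·) fun _ _ => Commutation.cons z), hzτ, fun y _ hy => ?_⟩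
      exact .cons_cons (List.isChain_cons_cons.mp hy).1 hzτ

theorem exists_isChain_of_commutations (σ : List ℕ) :
    ∃ τ : List ℕ, Relation.ReflTransGen Commutation σ τ ∧
      τ.IsChain fun a b => b ≤ a + 1 := by
  induction σ with
  | nil => exact ⟨[], .refl, .nil⟩
  | cons x σ ih =>
    obtain ⟨τ, hτ, hchain⟩ := ih
    obtain ⟨ρ, hρ, hρchain, -⟩ := exists_isChain_of_cons x τ hchain
    exact ⟨ρ, (hτ.lift (x :: ·) fun _ _ => Commutation.cons x).trans hρ, hρchain⟩

/-- Every finite sequence of natural numbers can be transformed by a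
finite sequence of commutations into a sequence in sawtooth form; in particular the
result is a permutation of the original sequence, so it has the same number of entries
equal to any given value. -/
theorem exists_sawtooth_of_commutations (σ : List ℕ) :
    ∃ τ : List ℕ, Relation.ReflTransGen Commutation σ τ ∧ Sawtooth τ ∧
      σ.Perm τ ∧ ∀ v : ℕ, τ.count v = σ.count v := by
  obtain ⟨τ, hτ, hchain⟩ := exists_isChain_of_commutations σ
  have hperm := perm_of_reflTransGen_commutation hτ
  exact ⟨τ, hτ, .of_isChain hchain, hperm, fun v => (hperm.count_eq v).symm⟩
end

section
/- Let σ = (j_1, …, j_N) be a finite sequence of natural numbers that is not in sawtooth form, let k be the largest index such that j_{k+1} > j_k + 1, and let m be the largest index with m ≥ k+1 such that j_l > j_k + 1 for all k+1 ≤ l ≤ m. Then the sequence σ' = (j_1, …, j_{k−1}, j_{k+1}, …, j_m, j_k, j_{m+1}, …, j_N) is obtained from σ by m − k commutations, and either σ' is in sawtooth form or the largest index at which σ' fails to be in sawtooth form (i.e., the largest index i such that the (i+1)st entry of σ' exceeds the ith entry of σ' plus 1) is strictly less than k. -/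
/-- The sequence `σ` fails to be in sawtooth form at (0-based) index `i`. -/
def FailsAt (σ : List ℕ) (i : ℕ) : Prop :=
  i + 1 < σ.length ∧ σ.getD i 0 + 1 < σ.getD (i + 1) 0

/-- `CommChain n σ τ` : `τ` is obtained from `σ` by exactly `n` commutations. -/
def CommChain : ℕ → List ℕ → List ℕ → Prop
  | 0, σ, τ => σ = τ
  | n + 1, σ, τ => ∃ υ, Commutation σ υ ∧ CommChain n υ τ

theorem commChain_move_past (x : ℕ) (s l r : List ℕ) (h : ∀ y ∈ s, x + 1 < y) :
    CommChain s.length (l ++ x :: (s ++ r)) (l ++ s ++ x :: r) := by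
  induction s generalizing l with
  | nil => simp [CommChain]
  | cons y s ih =>
    refine ⟨l ++ y :: x :: (s ++ r), ⟨l, s ++ r, x, y, Or.inl (h y (by simp)), rfl, rfl⟩, ?_⟩
    simpa using ih (l ++ [y]) fun z hz => h z (by simp [hz])

theorem sawtooth_iff_forall_not_failsAt (σ : List ℕ) : Sawtooth σ ↔ ∀ i, ¬ FailsAt σ i := by
  refine ⟨fun h i hi => ?_, fun h i hi hlt => ?_⟩
  · have := h i hi.1 (by have := hi.2; omega)
    have := hi.2
    omega
  · by_contra hne
    exact h i ⟨hi, by omega⟩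

theorem sawtooth_or_exists_max_failsAt_lt (σ : List ℕ) (k : ℕ) (h : ∀ i, FailsAt σ i → i < k) :
    Sawtooth σ ∨ ∃ k', FailsAt σ k' ∧ (∀ i, FailsAt σ i → i ≤ k') ∧ k' < k := by
  classical
  by_cases hex : ∃ i, FailsAt σ i
  · obtain ⟨i, hi⟩ := hex
    have hg : FailsAt σ (Nat.findGreatest (FailsAt σ) k) :=
      Nat.findGreatest_spec (h i hi).le hi
    exact Or.inr ⟨_, hg, fun j hj => Nat.le_findGreatest (h j hj).le hj, h _ hg⟩
  · exact Or.inl ((sawtooth_iff_forall_not_failsAt σ).2 fun i hi => hex ⟨i, hi⟩)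

/-- The entries of a sequence in which the entry at `k` has been moved to position `m`. -/
theorem getD_move (σ : List ℕ) (k m i : ℕ) (hkm : k < m) (hm : m < σ.length) :
    (σ.take k ++ (σ.drop (k + 1)).take (m - k) ++ [σ.getD k 0] ++ σ.drop (m + 1)).getD i 0 =
      if i < k then σ.getD i 0 else if i < m then σ.getD (i + 1) 0
      else if i = m then σ.getD k 0 else σ.getD i 0 := by
  have hk : min k σ.length = k := by omega
  have hmk : min (m - k) (σ.length - (k + 1)) = m - k := by omega
  simp only [List.getD_eq_getElem?_getD, List.getElem?_append, List.length_append,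
    List.length_take, List.length_drop, List.length_singleton, List.getElem?_take,
    List.getElem?_drop, hk, hmk]
  rcases lt_or_ge i k with h1 | h1
  · simp [h1, show i < k + (m - k) + 1 by omega, show i < k + (m - k) by omega]
  rcases lt_trichotomy i m with h2 | rfl | h2
  · simp [h2, h1.not_gt, show i < k + (m - k) + 1 by omega, show i < k + (m - k) by omega,
      show i - k < m - k by omega, show k + 1 + (i - k) = i + 1 by omega]
  · simp [h1.not_gt, show k + (i - k) = i by omega]
  · simp [h1.not_gt, h2.not_gt, h2.ne', show ¬ i < k + (m - k) + 1 by omega,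
      show m + 1 + (i - (k + (m - k) + 1)) = i by omega]

/-- If `k` is the largest index at which `σ` fails to be in sawtooth
form and `m ≥ k+1` is the largest index such that every entry in positions `k+1,…,m`
exceeds `σ k + 1`, then moving the entry at position `k` past positions `k+1,…,m`
is achieved by `m − k` commutations, and the resulting sequence is either in sawtooth
form or its largest failure index is strictly less than `k`. -/
theorem sawtooth_failure_decreases (σ σ' : List ℕ) (k m : ℕ)
    (hk : FailsAt σ k) (hkmax : ∀ i, FailsAt σ i → i ≤ k)
    (hm1 : k + 1 ≤ m) (hm2 : m < σ.length)
    (hmall : ∀ l, k + 1 ≤ l → l ≤ m → σ.getD k 0 + 1 < σ.getD l 0)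
    (hmmax : ∀ m', k + 1 ≤ m' → m' < σ.length →
      (∀ l, k + 1 ≤ l → l ≤ m' → σ.getD k 0 + 1 < σ.getD l 0) → m' ≤ m)
    (hσ' : σ' = σ.take k ++ (σ.drop (k + 1)).take (m - k) ++ [σ.getD k 0]
      ++ σ.drop (m + 1)) :
    CommChain (m - k) σ σ' ∧
      (Sawtooth σ' ∨
        ∃ k', FailsAt σ' k' ∧ (∀ i, FailsAt σ' i → i ≤ k') ∧ k' < k) := by
  have hlen : σ'.length = σ.length := by
    rw [hσ']
    simp only [List.length_append, List.length_take, List.length_drop, List.length_singleton]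
    omega
  refine ⟨?_, sawtooth_or_exists_max_failsAt_lt σ' k fun i hi => ?_⟩
  · have hs : ∀ y ∈ (σ.drop (k + 1)).take (m - k), σ.getD k 0 + 1 < y := by
      intro y hy
      obtain ⟨j, hj, rfl⟩ := List.mem_iff_getElem.1 hy
      have hj' : j < m - k := by simp at hj; omega
      have := hmall (k + 1 + j) (by omega) (by omega)
      rw [List.getD_eq_getElem σ 0 (by omega : k + 1 + j < σ.length)] at this
      simpa only [List.getElem_take, List.getElem_drop] using this
    have hchain := commChain_move_past (σ.getD k 0) _ (σ.take k) (σ.drop (m + 1)) hs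
    have hsplit : σ = σ.take k ++ σ.getD k 0 ::
        ((σ.drop (k + 1)).take (m - k) ++ σ.drop (m + 1)) := by
      have hd : σ.drop (m + 1) = (σ.drop (k + 1)).drop (m - k) := by
        rw [List.drop_drop]
        congr 1
        omega
      rw [hd, List.take_append_drop, List.getD_eq_getElem σ 0 (by omega : k < σ.length),
        List.getElem_cons_drop, List.take_append_drop]
    rw [← hsplit] at hchain
    have hl : ((σ.drop (k + 1)).take (m - k)).length = m - k := by
      simp only [List.length_take, List.length_drop]
      omega
    rw [hl] at hchain
    simpa [hσ'] using hchain
  · by_contra! hik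
    obtain ⟨hi1, hi2⟩ := hi
    rw [hlen] at hi1
    rw [hσ', getD_move σ k m _ hm1 hm2, getD_move σ k m _ hm1 hm2] at hi2
    have hnot : ∀ j, k < j → j + 1 < σ.length → σ.getD (j + 1) 0 ≤ σ.getD j 0 + 1 := by
      intro j hj hj1
      by_contra! hlt
      have := hkmax j ⟨hj1, hlt⟩
      omega
    rcases lt_trichotomy i m with him | rfl | him
    · rcases Nat.lt_or_ge (i + 1) m with h1 | h1
      · have := hnot (i + 1) (by omega) (by omega)
        grind
      · obtain rfl : i + 1 = m := by omega
        have := hmall (i + 1) (by omega) le_rfl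
        grind
    · have hle : σ.getD (i + 1) 0 ≤ σ.getD k 0 + 1 := by
        by_contra! hlt
        have := hmmax (i + 1) (by omega) hi1 fun l hl1 hl2 => by
          rcases Nat.lt_or_ge i l with h | h
          · obtain rfl : l = i + 1 := by omega
            exact hlt
          · exact hmall l hl1 h
        omega
      grind
    · have := hnot i (by omega) hi1
      grind
end

section
/- Let n ≥ 2 and let σ be a finite sequence in sawtooth form with all entries in {1, …, n−1}. Let e_1, …, e_k be the ascending segments of G(σ) whose lowest dot has height 1, ordered from left to right, and for an ascending segment e let max(e) denote the height of its highest dot. If max(e_{i+1}) < max(e_i) for all 1 ≤ i < k, then σ has at most n−1 entries equal to 1. -/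
/-- `(i, j)` is a dot of the dot graph `G(σ)` (the first coordinate is 1-based). -/
def IsDot (σ : List ℕ) (i j : ℤ) : Prop :=
  ∃ k : Fin σ.length, i = ((k : ℕ) : ℤ) + 1 ∧ j = ((σ.get k : ℕ) : ℤ)

/-- The dots `(a, y), (a+1, y+1), …, (a+t, y+t)` all belong to `G(σ)`; equivalently
(for `0 ≤ t`) the dots `(a, y)` and `(a+t, y+t)` lie on a common ascending segment. -/
def OnAsc (σ : List ℕ) (a y t : ℤ) : Prop :=
  ∀ s : ℤ, 0 ≤ s → s ≤ t → IsDot σ (a + s) (y + s)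

/-- The dots `(a, y), …, (a+m, y+m)` form an entire (i.e. maximal) ascending segment. -/
def IsAscSeg (σ : List ℕ) (a y : ℤ) (m : ℕ) : Prop :=
  OnAsc σ a y (m : ℤ) ∧ ¬ IsDot σ (a - 1) (y - 1) ∧
    ¬ IsDot σ (a + (m : ℤ) + 1) (y + (m : ℤ) + 1)

theorem IsDot.height_mem {σ : List ℕ} {i j : ℤ} (h : IsDot σ i j) : ∃ x ∈ σ, j = (x : ℤ) := by
  obtain ⟨k, -, hj⟩ := h
  exact ⟨σ.get k, σ.get_mem k, hj⟩

/-- Every dot of height 1 is the lowest dot of an ascending segment when all entries are positive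
and bounded. -/
theorem exists_isAscSeg_one {σ : List ℕ} {b : ℕ} (hrange : ∀ x ∈ σ, 1 ≤ x ∧ x ≤ b) {a : ℤ}
    (ha : IsDot σ a 1) : ∃ m : ℕ, m < b ∧ IsAscSeg σ a 1 m := by
  classical
  have hex : ∃ m : ℕ, ¬ IsDot σ (a + (m : ℤ) + 1) (1 + (m : ℤ) + 1) := by
    refine ⟨b, fun h => ?_⟩
    obtain ⟨x, hx, hj⟩ := h.height_mem
    have := (hrange x hx).2
    omega
  have hasc : OnAsc σ a 1 (Nat.find hex : ℤ) := by
    intro s hs hst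
    lift s to ℕ using hs
    cases s with
    | zero => simpa using ha
    | succ s =>
      have h := not_not.mp (Nat.find_min hex (m := s) (by omega))
      convert h using 1 <;> push_cast <;> ring
  refine ⟨Nat.find hex, ?_, hasc, fun h => ?_, Nat.find_spec hex⟩
  · obtain ⟨x, hx, hj⟩ := (hasc _ (Int.natCast_nonneg _) le_rfl).height_mem
    have := (hrange x hx).2
    omega
  · obtain ⟨x, hx, hj⟩ := h.height_mem
    have := (hrange x hx).1
    omega

theorem List.count_eq_card_filter_get {α : Type*} [DecidableEq α] (l : List α) (x : α) :
    l.count x = (Finset.univ.filter fun k : Fin l.length => l.get k = x).card := by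
  conv_lhs => rw [← List.ofFn_get l]
  rw [← Multiset.coe_count, ← Fin.univ_val_map, Multiset.count_map]
  simp [Finset.card, eq_comm]

/-- Let `σ` be in sawtooth form with entries in `{1, …, n−1}`.  If the
maxima of the ascending segments of `G(σ)` whose lowest dot has height 1 strictly
decrease from left to right, then `σ` has at most `n−1` entries equal to 1.
(The ascending segment with lowest dot `(a, 1)` and length `m` has maximum height
`1 + m`, so the condition `max(e') < max(e)` for `e` to the left of `e'` reads
`m' < m`.) -/
theorem count_one_le_of_decreasing_maxima (n : ℕ) (hn : 2 ≤ n) (σ : List ℕ)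
    (hrange : ∀ x ∈ σ, 1 ≤ x ∧ x ≤ n - 1) (hsaw : Sawtooth σ)
    (hdec : ∀ (a a' : ℤ) (m m' : ℕ),
      IsAscSeg σ a 1 m → IsAscSeg σ a' 1 m' → a < a' → m' < m) :
    σ.count 1 ≤ n - 1 := by
  classical
  have hseg : ∀ k : Fin σ.length, σ.get k = 1 →
      ∃ m : ℕ, m < n - 1 ∧ IsAscSeg σ (((k : ℕ) : ℤ) + 1) 1 m := fun k hk =>
    exists_isAscSeg_one hrange ⟨k, rfl, by rw [hk]; rfl⟩
  choose! f hf hasc using hseg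
  rw [List.count_eq_card_filter_get]
  calc _ ≤ (Finset.range (n - 1)).card := by
        refine Finset.card_le_card_of_injOn f (fun k hk => ?_) (fun k hk l hl h => ?_)
        · simpa using hf k (by simpa using hk)
        · have hk' : σ.get k = 1 := by simpa using hk
          have hl' : σ.get l = 1 := by simpa using hl
          rcases lt_trichotomy k l with hlt | heq | hlt
          · have := hdec _ _ _ _ (hasc k hk') (hasc l hl') (by simpa using hlt)
            omega
          · exact heq
          · have := hdec _ _ _ _ (hasc l hl') (hasc k hk') (by simpa using hlt)
            omega
    _ = n - 1 := Finset.card_range _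
end

section
/- Let σ be a finite sequence of positive natural numbers in sawtooth form. Suppose e and e' are ascending segments of G(σ) such that every dot of e has first coordinate strictly less than every dot of e', the lowest dots of both e and e' have height 1, and the height of the highest dot of e' is greater than or equal to the height of the highest dot of e. Then G(σ) contains an unpierced box. -/
/-- A box of `G(σ)` with lower horizontal edge from `(a, y)` to `(b, y)` and
ascending edges of length `t`. -/
def IsBox (σ : List ℕ) (a b y t : ℤ) : Prop :=
  0 ≤ t ∧ a + t < b ∧
  OnAsc σ a y t ∧ ¬ IsDot σ (a + t + 1) (y + t + 1) ∧
  OnAsc σ b y t ∧ ¬ IsDot σ (b - 1) (y - 1)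

/-- No dot of `G(σ)` lies in the open interior of either horizontal edge of the box. -/
def BoxUnpierced (σ : List ℕ) (a b y t : ℤ) : Prop :=
  (∀ i : ℤ, a < i → i < b → ¬ IsDot σ i y) ∧
  (∀ i : ℤ, a + t < i → i < b + t → ¬ IsDot σ i (y + t))

/-- No dot of `G(σ)` lies in the open interior of the box. -/
def BoxEmpty (σ : List ℕ) (a b y t : ℤ) : Prop :=
  ∀ i h : ℤ, y < h → h < y + t → a + (h - y) < i → i < b + (h - y) → ¬ IsDot σ i h

/-- The closed region of the box. -/
def BoxRegion (a b y t : ℤ) : Set (ℤ × ℤ) :=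
  {p | y ≤ p.2 ∧ p.2 ≤ y + t ∧ a + (p.2 - y) ≤ p.1 ∧ p.1 ≤ b + (p.2 - y)}

/-- A hexagon of type 1 of `G(σ)`. -/
def IsHex1 (σ : List ℕ) (a b c y L M : ℤ) : Prop :=
  0 ≤ M ∧ M ≤ L ∧ a < b ∧ b + M < c ∧
  OnAsc σ a y L ∧ ¬ IsDot σ (a + L + 1) (y + L + 1) ∧
  OnAsc σ b y M ∧ ¬ IsDot σ (b - 1) (y - 1) ∧ ¬ IsDot σ (b + M + 1) (y + M + 1) ∧
  OnAsc σ c (y + M) (L - M)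

/-- No dot of `G(σ)` lies in the open interior of any of the three horizontal
edges of the type 1 hexagon. -/
def Hex1Unpierced (σ : List ℕ) (a b c y L M : ℤ) : Prop :=
  (∀ i : ℤ, a < i → i < b → ¬ IsDot σ i y) ∧
  (∀ i : ℤ, b + M < i → i < c → ¬ IsDot σ i (y + M)) ∧
  (∀ i : ℤ, a + L < i → i < c + L - M → ¬ IsDot σ i (y + L))

/-- The open interior of the type 1 hexagon. -/
def Hex1Interior (a b c y L M : ℤ) : Set (ℤ × ℤ) :=
  {p | y < p.2 ∧ p.2 < y + L ∧ a + (p.2 - y) < p.1 ∧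
    (p.2 ≤ y + M → p.1 < b + (p.2 - y)) ∧ (y + M ≤ p.2 → p.1 < c + (p.2 - y - M))}

/-- No dot of `G(σ)` lies in the open interior of the type 1 hexagon. -/
def Hex1Empty (σ : List ℕ) (a b c y L M : ℤ) : Prop :=
  ∀ p ∈ Hex1Interior a b c y L M, ¬ IsDot σ p.1 p.2

/-- The closed region of the type 1 hexagon (open interior together with its
horizontal and ascending edges). -/
def Hex1Region (a b c y L M : ℤ) : Set (ℤ × ℤ) :=
  {p | y ≤ p.2 ∧ p.2 ≤ y + L ∧ a + (p.2 - y) ≤ p.1 ∧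
    (p.2 < y + M → p.1 ≤ b + (p.2 - y)) ∧ (y + M ≤ p.2 → p.1 ≤ c + (p.2 - y - M))}

/-- A hexagon of type 2 of `G(σ)`. -/
def IsHex2 (σ : List ℕ) (p q r y L M : ℤ) : Prop :=
  0 ≤ M ∧ M ≤ L ∧ p < q ∧ p + (L - M) < r ∧ r + M < q + L ∧
  OnAsc σ p y (L - M) ∧
  OnAsc σ r (y + L - M) M ∧ ¬ IsDot σ (r - 1) (y + L - M - 1) ∧
    ¬ IsDot σ (r + M + 1) (y + L + 1) ∧
  OnAsc σ q y L ∧ ¬ IsDot σ (q - 1) (y - 1)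

/-- No dot of `G(σ)` lies in the open interior of any of the three horizontal
edges of the type 2 hexagon. -/
def Hex2Unpierced (σ : List ℕ) (p q r y L M : ℤ) : Prop :=
  (∀ i : ℤ, p < i → i < q → ¬ IsDot σ i y) ∧
  (∀ i : ℤ, p + (L - M) < i → i < r → ¬ IsDot σ i (y + L - M)) ∧
  (∀ i : ℤ, r + M < i → i < q + L → ¬ IsDot σ i (y + L))

/-- The open interior of the type 2 hexagon. -/
def Hex2Interior (p q r y L M : ℤ) : Set (ℤ × ℤ) :=
  {x | y < x.2 ∧ x.2 < y + L ∧ x.1 < q + (x.2 - y) ∧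
    (x.2 ≤ y + L - M → p + (x.2 - y) < x.1) ∧
    (y + L - M ≤ x.2 → r + (x.2 - y - L + M) < x.1)}

/-- No dot of `G(σ)` lies in the open interior of the type 2 hexagon. -/
def Hex2Empty (σ : List ℕ) (p q r y L M : ℤ) : Prop :=
  ∀ x ∈ Hex2Interior p q r y L M, ¬ IsDot σ x.1 x.2

/-- The closed region of the type 2 hexagon (open interior together with its
horizontal and ascending edges). -/
def Hex2Region (p q r y L M : ℤ) : Set (ℤ × ℤ) :=
  {x | y ≤ x.2 ∧ x.2 ≤ y + L ∧ x.1 ≤ q + (x.2 - y) ∧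
    (x.2 ≤ y + L - M → p + (x.2 - y) ≤ x.1) ∧
    (y + L - M < x.2 → r + (x.2 - y - L + M) ≤ x.1)}

/-- The number of dots of `G(σ)` lying in a region `R`. -/
noncomputable def DotsIn (σ : List ℕ) (R : Set (ℤ × ℤ)) : ℕ :=
  {p : ℤ × ℤ | IsDot σ p.1 p.2 ∧ p ∈ R}.ncard

/-- A region `RQ` is strictly inside a region `RP` (with respect to `G(σ)`) if
`RQ ⊆ RP` and `RQ` contains strictly fewer dots of `G(σ)` than `RP`. -/
def StrictlyInside (σ : List ℕ) (RQ RP : Set (ℤ × ℤ)) : Prop :=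
  RQ ⊆ RP ∧ DotsIn σ RQ < DotsIn σ RP

theorem IsDot.height_unique {σ : List ℕ} {i y z : ℤ} (h : IsDot σ i y) (h' : IsDot σ i z) :
    y = z := by
  obtain ⟨k, hk, rfl⟩ := h
  obtain ⟨l, hl, rfl⟩ := h'
  have : k = l := Fin.ext (by omega)
  rw [this]

theorem IsDot.le_length {σ : List ℕ} {i y : ℤ} (h : IsDot σ i y) : i ≤ σ.length := by
  obtain ⟨k, rfl, -⟩ := h
  have := k.isLt
  omega

theorem not_isDot_zero {σ : List ℕ} (hpos : ∀ x ∈ σ, 0 < x) (i : ℤ) : ¬ IsDot σ i 0 := by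
  rintro ⟨k, -, hk⟩
  have := hpos _ (List.get_mem σ k)
  omega

theorem OnAsc.mono {σ : List ℕ} {a y s t : ℤ} (h : OnAsc σ a y t) (hst : s ≤ t) :
    OnAsc σ a y s :=
  fun r h0 hr => h r h0 (hr.trans hst)

/-- Every dot in the columns of an ascending run lies on the line of that run. -/
theorem OnAsc.diagonal_eq {σ : List ℕ} {a y t i z : ℤ} (h : OnAsc σ a y t) (hd : IsDot σ i z)
    (hai : a ≤ i) (hit : i ≤ a + t) : z - i = y - a := by
  have h1 := h (i - a) (by omega) (by omega)
  rw [add_sub_cancel] at h1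
  have := hd.height_unique h1
  omega

theorem exists_last_of_run {P : ℕ → Prop} (h0 : P 0) {n : ℕ} (hn : ¬ P n) :
    ∃ k < n, (∀ s ≤ k, P s) ∧ ¬ P (k + 1) := by
  classical
  have hex : ∃ n, ¬ P n := ⟨n, hn⟩
  have hf : Nat.find hex ≠ 0 := fun h => Nat.find_spec hex (h ▸ h0)
  have hle : Nat.find hex ≤ n := Nat.find_min' hex hn
  refine ⟨Nat.find hex - 1, by omega, fun s hs => ?_, ?_⟩
  · exact not_not.mp (Nat.find_min hex (by omega))
  · rw [Nat.sub_add_cancel (by omega)]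
    exact Nat.find_spec hex

theorem IsDot.exists_top {σ : List ℕ} {i y : ℤ} (h : IsDot σ i y) {t : ℕ}
    (ht : ¬ IsDot σ (i + t) (y + t)) :
    ∃ k : ℕ, k < t ∧ OnAsc σ i y k ∧ ¬ IsDot σ (i + k + 1) (y + k + 1) := by
  obtain ⟨k, hk, hrun, hend⟩ :=
    exists_last_of_run (P := fun s : ℕ => IsDot σ (i + s) (y + s)) (by simpa using h) ht
  refine ⟨k, hk, fun s h0 hs => ?_, ?_⟩
  · lift s to ℕ using h0
    exact hrun s (by omega)
  · simpa [add_assoc] using hend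

theorem IsDot.exists_bottom {σ : List ℕ} {i y : ℤ} (h : IsDot σ i y) {t : ℕ}
    (ht : ¬ IsDot σ (i - t) (y - t)) :
    ∃ k : ℕ, k < t ∧ OnAsc σ (i - k) (y - k) k ∧ ¬ IsDot σ (i - k - 1) (y - k - 1) := by
  obtain ⟨k, hk, hrun, hend⟩ :=
    exists_last_of_run (P := fun s : ℕ => IsDot σ (i - s) (y - s)) (by simpa using h) ht
  refine ⟨k, hk, fun s h0 hs => ?_, ?_⟩
  · have := hrun (k - s).toNat (by omega)
    rw [Int.toNat_of_nonneg (by omega)] at this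
    convert this using 1 <;> ring
  · push_cast at hend
    simpa [sub_sub] using hend

theorem IsBox.exists_smaller_of_upper_pierced {σ : List ℕ} {a b y : ℤ} {t : ℕ}
    (hbox : IsBox σ a b y t) (hlow : ∀ i : ℤ, a < i → i < b → ¬ IsDot σ i y)
    (hpierced : ∃ i : ℤ, a + t < i ∧ i < b + t ∧ IsDot σ i (y + t)) :
    ∃ (a' b' y' : ℤ) (t' : ℕ), t' < t ∧ IsBox σ a' b' y' t' ∧
      ∀ i : ℤ, a' + t' < i → i < b' + t' → ¬ IsDot σ i (y' + t') := by
  obtain ⟨-, hab, hasc, htop, hasc', -⟩ := hbox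
  obtain ⟨i, ⟨hi1, hi2, hid⟩, hmin⟩ :=
    Int.exists_least_of_bdd ⟨a + t, fun z hz => hz.1.le⟩ hpierced
  have hib : i < b := by
    by_contra! hbi
    have := hasc'.diagonal_eq hid hbi hi2.le
    omega
  have hnot : ¬ IsDot σ (i - t) (y + t - t) := by
    rw [add_sub_cancel_right]
    exact hlow _ (by omega) (by omega)
  obtain ⟨k, hk, hrun, hend⟩ := hid.exists_bottom hnot
  have hik : a + t < i - k := by
    by_contra! hle
    have hd := hrun 0 le_rfl (by omega)
    have := hasc.diagonal_eq hd (by omega) (by omega)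
    omega
  refine ⟨a + t - k, i - k, y + t - k, k, hk,
    ⟨by omega, by omega, fun s h0 hs => ?_, ?_, hrun, hend⟩, fun j hj1 hj2 hj => ?_⟩
  · convert hasc (t - k + s) (by omega) (by omega) using 1 <;> ring
  · simpa using htop
  · rw [sub_add_cancel] at hj hj1 hj2
    have := hmin j ⟨hj1, by omega, hj⟩
    omega

theorem IsBox.exists_smaller_of_lower_pierced {σ : List ℕ} {a b y : ℤ} {t : ℕ}
    (hbox : IsBox σ a b y t) (hup : ∀ i : ℤ, a + t < i → i < b + t → ¬ IsDot σ i (y + t))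
    (hpierced : ∃ i : ℤ, a < i ∧ i < b ∧ IsDot σ i y) :
    ∃ (a' b' y' : ℤ) (t' : ℕ), t' < t ∧ IsBox σ a' b' y' t' ∧
      ∀ i : ℤ, a' < i → i < b' → ¬ IsDot σ i y' := by
  obtain ⟨-, -, -, -, hasc', hbot⟩ := hbox
  obtain ⟨i, ⟨hi1, hi2, hid⟩, hmax⟩ :=
    Int.exists_greatest_of_bdd ⟨b, fun z hz => hz.2.1.le⟩ hpierced
  obtain ⟨k, hk, hrun, hend⟩ := hid.exists_top (hup (i + t) (by omega) (by omega))
  refine ⟨i, b, y, k, hk, ⟨by omega, ?_, hrun, hend, hasc'.mono (by omega), hbot⟩,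
    fun j hj1 hj2 hj => ?_⟩
  · by_contra! hle
    have hd := hrun k (by omega) le_rfl
    have := hasc'.diagonal_eq hd hle (by omega)
    omega
  · have := hmax j ⟨by omega, hj2, hj⟩
    omega

theorem IsBox.exists_unpierced_of_edge_unpierced {σ : List ℕ} {a b y : ℤ} {t : ℕ}
    (hbox : IsBox σ a b y t)
    (hedge : (∀ i : ℤ, a < i → i < b → ¬ IsDot σ i y) ∨
      (∀ i : ℤ, a + t < i → i < b + t → ¬ IsDot σ i (y + t))) :
    ∃ A B Y T : ℤ, IsBox σ A B Y T ∧ BoxUnpierced σ A B Y T := by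
  induction t using Nat.strong_induction_on generalizing a b y with
  | _ t ih =>
    rcases hedge with hlow | hup
    · by_cases hup : ∃ i : ℤ, a + t < i ∧ i < b + t ∧ IsDot σ i (y + t)
      · obtain ⟨a', b', y', t', ht, hbox', hup'⟩ :=
          hbox.exists_smaller_of_upper_pierced hlow hup
        exact ih t' ht hbox' (Or.inr hup')
      · exact ⟨a, b, y, t, hbox, hlow, fun i h1 h2 h3 => hup ⟨i, h1, h2, h3⟩⟩
    · by_cases hlow : ∃ i : ℤ, a < i ∧ i < b ∧ IsDot σ i y
      · obtain ⟨a', b', y', t', ht, hbox', hlow'⟩ :=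
          hbox.exists_smaller_of_lower_pierced hup hlow
        exact ih t' ht hbox' (Or.inl hlow')
      · exact ⟨a, b, y, t, hbox, fun i h1 h2 h3 => hlow ⟨i, h1, h2, h3⟩, hup⟩

theorem IsDot.exists_isAscSeg_one {σ : List ℕ} (hpos : ∀ x ∈ σ, 0 < x) {c : ℤ}
    (h : IsDot σ c 1) : ∃ m : ℕ, IsAscSeg σ c 1 m := by
  have hnot : ¬ IsDot σ (c + (σ.length + 1 - c).toNat) (1 + (σ.length + 1 - c).toNat) := by
    intro hd
    have := hd.le_length
    omega
  obtain ⟨k, -, hrun, hend⟩ := h.exists_top hnot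
  exact ⟨k, hrun, not_isDot_zero hpos _, hend⟩

/-- Two weakly increasing ascending segments of lowest height 1 span a box whose lower edge is
unpierced, after passing to a closest such pair. -/
theorem exists_isBox_lower_unpierced {σ : List ℕ} (hpos : ∀ x ∈ σ, 0 < x) {a a' : ℤ}
    {m m' : ℕ} (he : IsAscSeg σ a 1 m) (he' : IsAscSeg σ a' 1 m') (hlt : a < a')
    (hmax : m ≤ m') :
    ∃ (A B : ℤ) (t : ℕ), IsBox σ A B 1 t ∧ ∀ i : ℤ, A < i → i < B → ¬ IsDot σ i 1 := by
  induction hn : (a' - a).toNat using Nat.strong_induction_on generalizing a a' m m' with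
  | _ n ih =>
    by_cases hp : ∃ c, a < c ∧ c < a' ∧ IsDot σ c 1
    · obtain ⟨c, hc1, hc2, hc⟩ := hp
      obtain ⟨k, hk⟩ := hc.exists_isAscSeg_one hpos
      rcases le_total m k with h | h
      · exact ih _ (by omega) he hk hc1 h rfl
      · exact ih _ (by omega) hk he' hc2 (h.trans hmax) rfl
    · have hd := he'.1 0 le_rfl (by omega)
      refine ⟨a, a', m, ⟨by omega, ?_, he.1, he.2.2, he'.1.mono (by omega), he'.2.1⟩,
        fun i h1 h2 h3 => hp ⟨i, h1, h2, h3⟩⟩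
      by_contra! hle
      have := he.1.diagonal_eq hd (by omega) (by omega)
      omega

/-- Let `σ` be a sequence of positive natural numbers in sawtooth
form.  If `e` and `e'` are ascending segments of `G(σ)`, every dot of `e` lying
strictly to the left of every dot of `e'`, whose lowest dots both have height 1, and
with `max(e') ≥ max(e)`, then `G(σ)` contains an unpierced box. -/
theorem exists_unpierced_box (σ : List ℕ) (hpos : ∀ x ∈ σ, 0 < x)
    (hsaw : Sawtooth σ) (a a' : ℤ) (m m' : ℕ)
    (he : IsAscSeg σ a 1 m) (he' : IsAscSeg σ a' 1 m')
    (hleft : a + (m : ℤ) < a') (hmax : m ≤ m') :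
    ∃ A B Y T : ℤ, IsBox σ A B Y T ∧ BoxUnpierced σ A B Y T := by
  obtain ⟨A, B, t, hbox, hlow⟩ :=
    exists_isBox_lower_unpierced hpos he he' (by omega) hmax
  exact hbox.exists_unpierced_of_edge_unpierced (Or.inl hlow)
end

section
/- Let σ be a finite sequence of natural numbers in sawtooth form. If G(σ) contains a box P at most one of whose two horizontal edges has a dot of G(σ) in its open interior, then G(σ) contains an unpierced box whose closed region is contained in the closed region of P. -/
/-- A dot graph is the graph of a function: there is one dot per column. -/
theorem IsDot.height_unique_s5 {σ : List ℕ} {i j k : ℤ} (hj : IsDot σ i j) (hk : IsDot σ i k) :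
    j = k := by
  obtain ⟨m, hm, rfl⟩ := hj
  obtain ⟨n, hn, rfl⟩ := hk
  have : m = n := Fin.ext (by omega)
  rw [this]

/-- If a predicate holds at `0` and fails at `t ≥ 0`, there is a last index before the
first failure. -/
theorem exists_last_before_failure {P : ℤ → Prop} {t : ℤ} (ht : 0 ≤ t) (h0 : P 0)
    (hP : ¬ P t) :
    ∃ s : ℤ, 0 ≤ s ∧ s < t ∧ (∀ r, 0 ≤ r → r ≤ s → P r) ∧ ¬ P (s + 1) := by
  obtain ⟨m, ⟨hm0, hm⟩, hmin⟩ :=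
    Int.exists_least_of_bdd (P := fun r => 0 ≤ r ∧ ¬ P r) ⟨0, fun _ h => h.1⟩ ⟨t, ht, hP⟩
  have hne : m ≠ 0 := fun h => hm (h ▸ h0)
  have hmt := hmin t ⟨ht, hP⟩
  refine ⟨m - 1, by omega, by omega, fun r hr hrm => ?_, by simpa using hm⟩
  by_contra h
  have := hmin r ⟨hr, h⟩
  omega

/-- A box with clear lower edge whose upper edge is pierced contains a box of strictly
smaller height with clear upper edge. -/
theorem IsBox.exists_shorter_of_upper_pierced {σ : List ℕ} {a b y t : ℤ}
    (hbox : IsBox σ a b y t) (hlow : ∀ i : ℤ, a < i → i < b → ¬ IsDot σ i y)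
    (hup : ∃ i : ℤ, a + t < i ∧ i < b + t ∧ IsDot σ i (y + t)) :
    ∃ A B Y T : ℤ, T < t ∧ IsBox σ A B Y T ∧
      (∀ i : ℤ, A + T < i → i < B + T → ¬ IsDot σ i (Y + T)) ∧
      BoxRegion A B Y T ⊆ BoxRegion a b y t := by
  obtain ⟨ht, hab, ha, ha', -, -⟩ := hbox
  obtain ⟨c, ⟨hac, hcb, hc⟩, hmin⟩ := Int.exists_least_of_bdd ⟨a + t, fun _ h => h.1.le⟩ hup
  obtain ⟨s, hs0, hst, hseg, hend⟩ :=
    exists_last_before_failure (P := fun r => IsDot σ (c - r) (y + t - r)) ht (by simpa using hc)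
      (by simpa using hlow (c - t) (by omega) (by omega))
  have hdisj : a + t < c - s := by
    by_contra hle
    have h1 := hseg (c - (a + t)) (by omega) (by omega)
    rw [sub_sub_cancel] at h1
    have := h1.height_unique_s5 (ha t ht le_rfl)
    omega
  refine ⟨a + t - s, c - s, y + t - s, s, hst,
    ⟨hs0, by omega, fun r hr hrs => ?_, ?_, fun r hr hrs => ?_, ?_⟩, fun i hi hic hd => ?_, ?_⟩
  · convert ha (t - s + r) (by omega) (by omega) using 1 <;> ring
  · convert ha' using 2 <;> ring
  · convert hseg (s - r) (by omega) (by omega) using 1 <;> ring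
  · convert hend using 2 <;> ring
  · rw [sub_add_cancel] at hi hic hd
    have := hmin i ⟨hi, by omega, hd⟩
    omega
  · rintro ⟨u, v⟩ ⟨h1, h2, h3, h4⟩
    simp only at h1 h2 h3 h4
    refine ⟨?_, ?_, ?_, ?_⟩ <;> simp only <;> omega

/-- A box with clear upper edge whose lower edge is pierced contains a box of strictly
smaller height with clear lower edge. -/
theorem IsBox.exists_shorter_of_lower_pierced {σ : List ℕ} {a b y t : ℤ}
    (hbox : IsBox σ a b y t) (hup : ∀ i : ℤ, a + t < i → i < b + t → ¬ IsDot σ i (y + t))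
    (hlow : ∃ i : ℤ, a < i ∧ i < b ∧ IsDot σ i y) :
    ∃ A B Y T : ℤ, T < t ∧ IsBox σ A B Y T ∧
      (∀ i : ℤ, A < i → i < B → ¬ IsDot σ i Y) ∧
      BoxRegion A B Y T ⊆ BoxRegion a b y t := by
  obtain ⟨ht, hab, -, -, hb, hb'⟩ := hbox
  obtain ⟨c, ⟨hac, hcb, hc⟩, hmax⟩ := Int.exists_greatest_of_bdd ⟨b, fun _ h => h.2.1.le⟩ hlow
  obtain ⟨s, hs0, hst, hseg, hend⟩ :=
    exists_last_before_failure (P := fun r => IsDot σ (c + r) (y + r)) ht (by simpa using hc)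
      (hup (c + t) (by omega) (by omega))
  have hdisj : c + s < b := by
    by_contra hle
    have h1 := hseg (b - c) (by omega) (by omega)
    rw [add_sub_cancel] at h1
    have := h1.height_unique_s5 (by simpa using hb 0 le_rfl ht)
    omega
  refine ⟨c, b, y, s, hst,
    ⟨hs0, hdisj, hseg, by simpa only [add_assoc] using hend,
      fun r hr hrs => hb r hr (by omega), hb'⟩, fun i hi hib hd => ?_, ?_⟩
  · have := hmax i ⟨by omega, hib, hd⟩
    omega
  · rintro ⟨u, v⟩ ⟨h1, h2, h3, h4⟩
    simp only at h1 h2 h3 h4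
    refine ⟨?_, ?_, ?_, ?_⟩ <;> simp only <;> omega

/-- If `G(σ)` contains a box at most one of whose two horizontal edges
is pierced (i.e. at least one horizontal edge has no dot of `G(σ)` in its open
interior), then `G(σ)` contains an unpierced box whose closed region is contained in
the closed region of the given box. -/
theorem unpierced_box_of_once_pierced_box (σ : List ℕ) (hsaw : Sawtooth σ)
    (a b y t : ℤ) (hbox : IsBox σ a b y t)
    (hpierce : (∀ i : ℤ, a < i → i < b → ¬ IsDot σ i y) ∨
      (∀ i : ℤ, a + t < i → i < b + t → ¬ IsDot σ i (y + t))) :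
    ∃ A B Y T : ℤ, IsBox σ A B Y T ∧ BoxUnpierced σ A B Y T ∧
      BoxRegion A B Y T ⊆ BoxRegion a b y t := by
  obtain ⟨n, hn⟩ : ∃ n : ℕ, n = t.toNat := ⟨_, rfl⟩
  induction n using Nat.strong_induction_on generalizing a b y t with
  | _ n ih =>
    have ht := hbox.1
    have descend : ∀ {A B Y T : ℤ}, T < t → IsBox σ A B Y T →
        ((∀ i : ℤ, A < i → i < B → ¬ IsDot σ i Y) ∨
          (∀ i : ℤ, A + T < i → i < B + T → ¬ IsDot σ i (Y + T))) →
        BoxRegion A B Y T ⊆ BoxRegion a b y t →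
        ∃ A B Y T : ℤ, IsBox σ A B Y T ∧ BoxUnpierced σ A B Y T ∧
          BoxRegion A B Y T ⊆ BoxRegion a b y t := by
      intro A B Y T hT hB hclear hsub
      have hT0 := hB.1
      obtain ⟨A', B', Y', T', h1, h2, h3⟩ := ih _ (by omega) A B Y T hB hclear rfl
      exact ⟨A', B', Y', T', h1, h2, h3.trans hsub⟩
    rcases hpierce with hlow | hup
    · by_cases hup : ∃ i : ℤ, a + t < i ∧ i < b + t ∧ IsDot σ i (y + t)
      · obtain ⟨A, B, Y, T, hT, hB, hclear, hsub⟩ := hbox.exists_shorter_of_upper_pierced hlow hup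
        exact descend hT hB (Or.inr hclear) hsub
      · exact ⟨a, b, y, t, hbox, ⟨hlow, fun i h1 h2 h => hup ⟨i, h1, h2, h⟩⟩, subset_rfl⟩
    · by_cases hlow : ∃ i : ℤ, a < i ∧ i < b ∧ IsDot σ i y
      · obtain ⟨A, B, Y, T, hT, hB, hclear, hsub⟩ := hbox.exists_shorter_of_lower_pierced hup hlow
        exact descend hT hB (Or.inl hclear) hsub
      · exact ⟨a, b, y, t, hbox, ⟨fun i h1 h2 h => hlow ⟨i, h1, h2, h⟩, hup⟩, subset_rfl⟩
end

section
/- Let σ be a finite sequence of natural numbers in sawtooth form. If P is an unpierced box of G(σ) that is not empty, then G(σ) contains an unpierced box or an unpierced hexagon of type 1 that is strictly inside P. -/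
/-- The entry of `σ` in the (1-based) column `i`. -/
def colHeight (σ : List ℕ) (i : ℤ) : ℤ := ((σ.getD (i - 1).toNat 0 : ℕ) : ℤ)

theorem isDot_iff (σ : List ℕ) (i j : ℤ) :
    IsDot σ i j ↔ 1 ≤ i ∧ i ≤ σ.length ∧ colHeight σ i = j := by
  constructor
  · rintro ⟨⟨k, hk⟩, rfl, rfl⟩
    refine ⟨by simp, by simp; omega, ?_⟩
    simp [colHeight, hk]
  · rintro ⟨h1, h2, rfl⟩
    have hk : (i - 1).toNat < σ.length := by omega
    refine ⟨⟨(i - 1).toNat, hk⟩, by simp; omega, ?_⟩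
    simp only [colHeight, List.getD_eq_getElem _ _ hk, List.get_eq_getElem]

theorem Sawtooth.colHeight_add_one_le {σ : List ℕ} (hsaw : Sawtooth σ) {i : ℤ} (h1 : 1 ≤ i)
    (h2 : i + 1 ≤ σ.length) : colHeight σ (i + 1) ≤ colHeight σ i + 1 := by
  have h := hsaw (i - 1).toNat (by omega)
  have e : (i + 1 - 1).toNat = (i - 1).toNat + 1 := by omega
  unfold colHeight
  rw [e]
  omega

theorem finite_setOf_isDot (σ : List ℕ) : {p : ℤ × ℤ | IsDot σ p.1 p.2}.Finite := by
  refine (Set.finite_range fun k : Fin σ.length =>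
    (((k : ℕ) : ℤ) + 1, ((σ.get k : ℕ) : ℤ))).subset ?_
  rintro ⟨i, j⟩ ⟨k, rfl, rfl⟩
  exact ⟨k, rfl⟩

theorem strictlyInside_of_dot_notMem {σ : List ℕ} {R R' : Set (ℤ × ℤ)} (hsub : R ⊆ R') {i j : ℤ}
    (hdot : IsDot σ i j) (hmem : (i, j) ∈ R') (hnot : (i, j) ∉ R) : StrictlyInside σ R R' := by
  refine ⟨hsub, Set.ncard_lt_ncard ?_ ((finite_setOf_isDot σ).subset fun p hp => hp.1)⟩
  have hle : {p : ℤ × ℤ | IsDot σ p.1 p.2 ∧ p ∈ R} ⊆ {p | IsDot σ p.1 p.2 ∧ p ∈ R'} :=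
    fun p hp => ⟨hp.1, hsub hp.2⟩
  exact (Set.ssubset_iff_of_subset hle).2
    ⟨(i, j), ⟨hdot, hmem⟩, fun h => hnot h.2⟩

/-- Among intervals `[p, q]` (those with `R p q`), each carrying the height range `[f p, f q]`,
suppose `[p, q]` precedes `[p', q']`, their height ranges cross upwards, and no interval between
them has a height range extending strictly beyond both. Then some pair of intervals whose ranges
cross upwards has no interval between attaining the lowest height of the second or the highest
height of the first. -/
theorem exists_unobstructed_pair {R : ℤ → ℤ → Prop} (hR : ∀ p q, R p q → p ≤ q) (f : ℤ → ℤ) (n : ℕ) :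
    ∀ p q p' q' : ℤ, R p q → R p' q' → q < p' → p' - q ≤ n →
      f p ≤ f p' → f p' ≤ f q → f q ≤ f q' →
      (∀ k k', R k k' → q < k → k' < p' → ¬ (f k < f p ∧ f q' < f k')) →
      ∃ p q p' q' : ℤ, R p q ∧ R p' q' ∧ q < p' ∧ f p ≤ f p' ∧ f p' ≤ f q ∧ f q ≤ f q' ∧
        ∀ k k', R k k' → q < k → k' < p' →
          ¬ (f k ≤ f p' ∧ f p' ≤ f k') ∧ ¬ (f k ≤ f q ∧ f q ≤ f k') := by
  induction n with
  | zero => intro p q p' q' _ _ h1 h2; push_cast at h2; omega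
  | succ n ih =>
    intro p q p' q' hi hj hlt hn h1 h2 h3 hbig
    push_cast at hn
    by_contra hno
    have ih' : ∀ p q p' q' : ℤ, R p q → R p' q' → q < p' → p' - q ≤ n →
        f p ≤ f p' → f p' ≤ f q → f q ≤ f q' →
        ∃ k k', R k k' ∧ q < k ∧ k' < p' ∧ f k < f p ∧ f q' < f k' := by
      intro p q p' q' g1 g2 g3 g4 g5 g6 g7
      by_contra hc
      exact hno (ih p q p' q' g1 g2 g3 g4 g5 g6 g7
        fun k k' x1 x2 x3 x4 => hc ⟨k, k', x1, x2, x3, x4.1, x4.2⟩)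
    have hA : ∀ k k', R k k' → q < k → k' < p' →
        ¬ (f k ≤ f p ∧ f p' ≤ f k' ∧ f k' ≤ f q') := by
      rintro k k' hk x1 x2 ⟨x3, x4, x5⟩
      have := hR k k' hk
      obtain ⟨m, m', hm, y1, y2, y3, y4⟩ :=
        ih' k k' p' q' hk hj x2 (by omega) (by omega) x4 x5
      exact hbig m m' hm (by omega) y2 ⟨by omega, y4⟩
    have hB : ∀ k k', R k k' → q < k → k' < p' →
        ¬ (f q' ≤ f k' ∧ f p ≤ f k ∧ f k ≤ f q) := by
      rintro k k' hk x1 x2 ⟨x3, x4, x5⟩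
      have := hR k k' hk
      obtain ⟨m, m', hm, y1, y2, y3, y4⟩ :=
        ih' p q k k' hi hk x1 (by omega) x4 x5 (by omega)
      exact hbig m m' hm y1 (by omega) ⟨y3, by omega⟩
    refine hno ⟨p, q, p', q', hi, hj, hlt, h1, h2, h3, fun k k' hk x1 x2 => ?_⟩
    have hkk := hR k k' hk
    have b0 := hbig k k' hk x1 x2
    have b1 := hA k k' hk x1 x2
    have b2 := hB k k' hk x1 x2
    constructor
    · rintro ⟨z1, z2⟩
      have z3 : f p < f k := by omega
      have z4 : f k' < f q' := by omega
      obtain ⟨m, m', hm, y1, y2, y3, y4⟩ :=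
        ih' k k' p' q' hk hj x2 (by omega) z1 z2 z4.le
      have c0 := hbig m m' hm (by omega) y2
      exact hB m m' hm (by omega) y2 ⟨y4.le, by omega, by omega⟩
    · rintro ⟨z1, z2⟩
      have z3 : f p < f k := by omega
      have z4 : f k' < f q' := by omega
      obtain ⟨m, m', hm, y1, y2, y3, y4⟩ :=
        ih' p q k k' hi hk x1 (by omega) z3.le z1 z2
      have c0 := hbig m m' hm y1 (by omega)
      exact hA m m' hm y1 (by omega) ⟨y3.le, by omega, by omega⟩

/-- The columns `p, …, q` lie strictly between `u` and `v` and carry a maximal run of heights of `f`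
increasing by one. -/
structure IsRun (f : ℤ → ℤ) (u v p q : ℤ) : Prop where
  lt_left : u < p
  le : p ≤ q
  lt_right : q < v
  height : ∀ x, p ≤ x → x ≤ q → f x = f p + (x - p)
  left_maximal : f (p - 1) ≠ f p - 1
  right_maximal : f (q + 1) ≠ f q + 1

theorem IsRun.eq_or_disjoint {f : ℤ → ℤ} {u v p q p' q' x : ℤ} (h : IsRun f u v p q)
    (h' : IsRun f u v p' q') (hx : p' ≤ x) (hx' : x ≤ q') (hout : x < p ∨ q < x) :
    q' < p ∨ q < p' := by
  have l := h.le
  have l' := h'.le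
  by_contra hc
  push Not at hc
  rcases hout with hlt | hlt
  · have e1 := h'.height (p - 1) (by omega) (by omega)
    have e2 := h'.height p (by omega) (by omega)
    exact h.left_maximal (by omega)
  · have e1 := h'.height q (by omega) (by omega)
    have e2 := h'.height (q + 1) (by omega) (by omega)
    exact h.right_maximal (by omega)

theorem exists_isRun {f : ℤ → ℤ} {u v : ℤ} (hu : f (u + 1) ≠ f u + 1) (hv : f v ≠ f (v - 1) + 1)
    {x : ℤ} (hux : u < x) (hxv : x < v) : ∃ p q, IsRun f u v p q ∧ p ≤ x ∧ x ≤ q := by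
  obtain ⟨p, ⟨hp1, hp2, hp3⟩, hpmin⟩ := Int.exists_least_of_bdd
    (P := fun p => u < p ∧ p ≤ x ∧ ∀ z, p ≤ z → z ≤ x → f z = f x - (x - z))
    ⟨u, fun z hz => hz.1.le⟩
    ⟨x, hux, le_rfl, fun z h1 h2 => by obtain rfl : z = x := by omega
                                       ring⟩
  obtain ⟨q, ⟨hq1, hq2, hq3⟩, hqmax⟩ := Int.exists_greatest_of_bdd
    (P := fun q => x ≤ q ∧ q < v ∧ ∀ z, x ≤ z → z ≤ q → f z = f x + (z - x))
    ⟨v, fun z hz => hz.2.1.le⟩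
    ⟨x, le_rfl, hxv, fun z h1 h2 => by obtain rfl : z = x := by omega
                                       ring⟩
  have ep := hp3 p le_rfl hp2
  have eq := hq3 q hq1 le_rfl
  refine ⟨p, q, ⟨hp1, by omega, hq2, fun z h1 h2 => ?_, fun hc => ?_, fun hc => ?_⟩, hp2, hq1⟩
  · rcases le_total z x with h | h
    · have := hp3 z h1 h
      omega
    · have := hq3 z h h2
      omega
  · rcases eq_or_ne (p - 1) u with rfl | hne
    · exact hu (by rw [show p - 1 + 1 = p by ring]; omega)
    · have := hpmin (p - 1) ⟨by omega, by omega, fun z h1 h2 => ?_⟩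
      · omega
      · rcases eq_or_ne z (p - 1) with rfl | hz
        · omega
        · exact hp3 z (by omega) h2
  · rcases eq_or_ne (q + 1) v with rfl | hne
    · exact hv (by rw [show q + 1 - 1 = q by ring]; omega)
    · have := hqmax (q + 1) ⟨by omega, by omega, fun z h1 h2 => ?_⟩
      · omega
      · rcases eq_or_ne z (q + 1) with rfl | hz
        · omega
        · exact hq3 z h1 (by omega)

theorem exists_longest_isRun {f : ℤ → ℤ} {u v p q : ℤ} (h : IsRun f u v p q) :
    ∃ p q, IsRun f u v p q ∧ ∀ p' q', IsRun f u v p' q' → q' - p' ≤ q - p := by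
  have hfin : {z : ℤ × ℤ | IsRun f u v z.1 z.2}.Finite :=
    ((Set.finite_Icc u v).prod (Set.finite_Icc u v)).subset fun z hz =>
      ⟨⟨hz.lt_left.le, (hz.le.trans_lt hz.lt_right).le⟩,
        ⟨(hz.lt_left.trans_le hz.le).le, hz.lt_right.le⟩⟩
  obtain ⟨⟨p, q⟩, hm, hmax⟩ := Set.exists_max_image _ (fun z : ℤ × ℤ => z.2 - z.1) hfin ⟨(p, q), h⟩
  exact ⟨p, q, hm, fun p' q' h' => hmax (p', q') h'⟩

/-- A nonempty sequence of runs either has a run whose lowest height does not occur before it and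
whose highest height does not occur after it, or an unobstructed upwards crossing pair. -/
theorem exists_isolated_run_or_pair {f : ℤ → ℤ} {u v x : ℤ} (hu : f (u + 1) ≠ f u + 1)
    (hv : f v ≠ f (v - 1) + 1) (hux : u < x) (hxv : x < v) :
    (∃ p q, IsRun f u v p q ∧ (∀ z, u < z → z < p → f z ≠ f p) ∧
      (∀ z, q < z → z < v → f z ≠ f q)) ∨
    (∃ p q p' q', IsRun f u v p q ∧ IsRun f u v p' q' ∧ q < p' ∧
      f p ≤ f p' ∧ f p' ≤ f q ∧ f q ≤ f q' ∧
      ∀ z, q < z → z < p' → f z ≠ f p' ∧ f z ≠ f q) := by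
  have hrun := fun {x : ℤ} => exists_isRun (x := x) hu hv
  obtain ⟨_, _, h0, _⟩ := hrun hux hxv
  obtain ⟨p, q, h, hmax⟩ := exists_longest_isRun h0
  have l := h.le
  have top : ∀ {p q}, IsRun f u v p q → f q = f p + (q - p) := fun h => h.height _ h.le le_rfl
  have tp := top h
  by_cases hiso : (∀ z, u < z → z < p → f z ≠ f p) ∧ (∀ z, q < z → z < v → f z ≠ f q)
  · exact Or.inl ⟨p, q, h, hiso⟩
  right
  suffices hs : ∃ p q p' q', IsRun f u v p q ∧ IsRun f u v p' q' ∧ q < p' ∧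
      f p ≤ f p' ∧ f p' ≤ f q ∧ f q ≤ f q' ∧
      ∀ k k', IsRun f u v k k' → q < k → k' < p' → ¬ (f k < f p ∧ f q' < f k') by
    obtain ⟨p, q, p', q', g1, g2, g3, g4, g5, g6, g7⟩ := hs
    obtain ⟨p, q, p', q', g1, g2, g3, g4, g5, g6, g7⟩ :=
      exists_unobstructed_pair (fun p q (h : IsRun f u v p q) => h.le) f (p' - q).toNat p q p' q'
        g1 g2 g3 (by omega) g4 g5 g6 g7
    refine ⟨p, q, p', q', g1, g2, g3, g4, g5, g6, fun z hz hz' => ?_⟩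
    have l1 := g1.le
    have l2 := g2.le
    have := g1.lt_left
    have := g2.lt_right
    obtain ⟨k, k', hk, hkz, hzk⟩ := hrun (show u < z by omega) (by omega)
    have d1 := g1.eq_or_disjoint hk hkz hzk (Or.inr hz)
    have d2 := g2.eq_or_disjoint hk hkz hzk (Or.inl hz')
    have o := g7 k k' hk (by omega) (by omega)
    have e := hk.height z hkz hzk
    have e' := top hk
    omega
  rw [not_and_or] at hiso
  push Not at hiso
  have hbig : ∀ k k', IsRun f u v k k' → ¬ (f k ≤ f p ∧ f q ≤ f k' ∧ (f k < f p ∨ f q < f k')) := by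
    intro k k' hk hc
    have := hmax k k' hk
    have := top hk
    omega
  rcases hiso with ⟨z, hz, hz', e⟩ | ⟨z, hz, hz', e⟩
  · obtain ⟨k, k', hk, hkz, hzk⟩ := hrun hz (by have := h.lt_right; omega)
    have d := h.eq_or_disjoint hk hkz hzk (Or.inl hz')
    have e1 := hk.height z hkz hzk
    have e2 := top hk
    have b := hbig k k' hk
    refine ⟨k, k', p, q, hk, h, by omega, by omega, by omega, by omega, fun m m' hm _ _ c => ?_⟩
    have := hbig m m' hm
    omega
  · obtain ⟨k, k', hk, hkz, hzk⟩ := hrun (show u < z by have := h.lt_left; omega) hz'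
    have d := h.eq_or_disjoint hk hkz hzk (Or.inr hz)
    have e1 := hk.height z hkz hzk
    have e2 := top hk
    have b := hbig k k' hk
    refine ⟨p, q, k, k', h, hk, by omega, by omega, by omega, by omega, fun m m' hm _ _ c => ?_⟩
    have := hbig m m' hm
    omega

/-- If `P` is an unpierced box of `G(σ)` that is not empty, then
`G(σ)` contains an unpierced box or an unpierced hexagon of type 1 that is strictly
inside `P`. -/
theorem unpierced_box_not_empty (σ : List ℕ) (hsaw : Sawtooth σ)
    (a b y t : ℤ) (hbox : IsBox σ a b y t) (hunp : BoxUnpierced σ a b y t)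
    (hne : ¬ BoxEmpty σ a b y t) :
    (∃ A B Y T : ℤ, IsBox σ A B Y T ∧ BoxUnpierced σ A B Y T ∧
      StrictlyInside σ (BoxRegion A B Y T) (BoxRegion a b y t)) ∨
    (∃ A B C Y L M : ℤ, IsHex1 σ A B C Y L M ∧ Hex1Unpierced σ A B C Y L M ∧
      StrictlyInside σ (Hex1Region A B C Y L M) (BoxRegion a b y t)) := by
  obtain ⟨ht, hab, hl, hl', hr, hr'⟩ := hbox
  obtain ⟨hlow, htop⟩ := hunp
  have hby : IsDot σ b y := by simpa using hr 0 le_rfl ht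
  set f := colHeight σ with hf
  simp only [BoxEmpty, OnAsc, isDot_iff, ← hf] at hl hl' hr hr' hlow htop hne
  have ha1 : 1 ≤ a := by simpa using (hl 0 le_rfl ht).1
  have hbN : b + t ≤ σ.length := (hr t ht le_rfl).2.1
  have hstep : ∀ x, a ≤ x → x < b → f (x + 1) ≤ f x + 1 := fun x h1 h2 =>
    hsaw.colHeight_add_one_le (by omega) (by omega)
  have hleft : ∀ x, a ≤ x → x ≤ a + t → f x = y + (x - a) := fun x h1 h2 => by
    have := (hl (x - a) (by omega) (by omega)).2.2
    rwa [show a + (x - a) = x by ring] at this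
  have hright : ∀ x, b ≤ x → x ≤ b + t → f x = y + (x - b) := fun x h1 h2 => by
    have := (hr (x - b) (by omega) (by omega)).2.2
    rwa [show b + (x - b) = x by ring] at this
  have hlow' : ∀ x, a < x → x < b → f x ≠ y := fun x h1 h2 e =>
    hlow x h1 h2 ⟨by omega, by omega, e⟩
  have htop' : ∀ x, a + t < x → x < b + t → f x ≠ y + t := fun x h1 h2 e =>
    htop x h1 h2 ⟨by omega, by omega, e⟩
  have hu : f (a + t + 1) ≠ y + t + 1 := fun e => hl' ⟨by omega, by omega, e⟩
  have hv : f (b - 1) ≠ y - 1 := fun e => hr' ⟨by omega, by omega, e⟩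
  have hat := hleft (a + t) (by omega) le_rfl
  have hfb := hright b le_rfl (by omega)
  obtain ⟨x₀, hx₀, hx₀', ht1⟩ : ∃ x, a + t < x ∧ x < b ∧ 1 ≤ t := by
    by_contra hc
    push Not at hc
    refine hne fun i h h1 h2 h3 h4 ⟨_, _, e⟩ => ?_
    rcases le_or_gt i (a + t) with hi | hi
    · have := hleft i (by omega) hi
      omega
    rcases lt_or_ge i b with hi' | hi'
    · have := hc i hi hi'
      omega
    · have := hright i hi' (by omega)
      omega
  have hupper : ∀ x, a + t + 1 ≤ x → x < b → f x < y + t := by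
    refine Int.leInduction (motive := fun x _ => x < b → f x < y + t) ?_ ?_
    · intro h
      have := hstep (a + t) (by omega) (by omega)
      have := htop' (a + t + 1) (by omega) (by omega)
      omega
    · intro x hx ihx h
      have := ihx (by omega)
      have := hstep x (by omega) (by omega)
      have := htop' (x + 1) (by omega) (by omega)
      omega
  have hlower : ∀ x, x ≤ b - 1 → a + t < x → y < f x := by
    refine Int.leInductionDown (motive := fun x _ => a + t < x → y < f x) ?_ ?_
    · intro h
      have := hstep (b - 1) (by omega) (by omega)
      have := hlow' (b - 1) (by omega) (by omega)
      rw [show b - 1 + 1 = b by ring] at *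
      omega
    · intro x hx ihx h
      have := ihx (by omega)
      have := hstep (x - 1) (by omega) (by omega)
      have := hlow' (x - 1) (by omega) (by omega)
      rw [show x - 1 + 1 = x by ring] at *
      omega
  rcases exists_isolated_run_or_pair (f := f) (u := a + t) (v := b) (by omega)
      (by have := hlower (b - 1) le_rfl (by omega)
          omega) hx₀ hx₀' with
    ⟨p, q, h, hbefore, hafter⟩ | ⟨p, q, p', q', h, h', hlt, h1, h2, h3, hclean⟩
  · right
    obtain ⟨r1, r2, r3, r4, r5, r6⟩ := h
    have e := r4 q r2 le_rfl
    have := hlower p (by omega) (by omega)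
    have := hupper q (by omega) (by omega)
    refine ⟨a + (f p - y), p, b + (f q - y), f p, y + t - f p, f q - f p, ?_, ?_, ?_⟩
    · simp only [IsHex1, OnAsc, isDot_iff, ← hf]
      refine ⟨by omega, by omega, by omega, by omega, fun s s0 s1 => ?_, fun hc => hu ?_,
        fun s s0 s1 => ?_, fun hc => r5 hc.2.2, fun hc => r6 ?_, fun s s0 s1 => ?_⟩
      · exact ⟨by omega, by omega, by rw [hleft _ (by omega) (by omega)]; ring⟩
      · have := hc.2.2
        ring_nf at this ⊢
        exact this
      · exact ⟨by omega, by omega, by rw [r4 _ (by omega) (by omega)]; ring⟩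
      · have := hc.2.2
        rw [show p + (f q - f p) + 1 = q + 1 by omega] at this
        omega
      · exact ⟨by omega, by omega, by rw [hright _ (by omega) (by omega)]; ring⟩
    · simp only [Hex1Unpierced, isDot_iff, ← hf]
      refine ⟨fun i i1 i2 hc => ?_, fun i i1 i2 hc => ?_, fun i i1 i2 hc => ?_⟩
      · rcases le_or_gt i (a + t) with hi | hi
        · have := hleft i (by omega) hi
          omega
        · exact hbefore i hi i2 hc.2.2
      · rcases lt_or_ge i b with hi | hi
        · exact hafter i (by omega) hi (by omega)
        · have := hright i hi (by omega)
          omega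
      · exact htop' i (by omega) (by omega) (by omega)
    · refine strictlyInside_of_dot_notMem ?_ hby ?_ ?_
      · rintro ⟨i, j⟩ ⟨c1, c2, c3, c4, c5⟩
        dsimp only at *
        refine ⟨?_, ?_, ?_, ?_⟩ <;> dsimp only
        · omega
        · omega
        · omega
        · by_cases j < f p + (f q - f p) <;> omega
      · refine ⟨?_, ?_, ?_, ?_⟩ <;> dsimp only <;> omega
      · rintro ⟨c1, -⟩
        dsimp only at c1
        omega
  · left
    obtain ⟨r1, r2, r3, r4, r5, r6⟩ := h
    obtain ⟨r1', r2', r3', r4', r5', r6'⟩ := h'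
    have e := r4 q r2 le_rfl
    have e' := r4' q' r2' le_rfl
    have := hlower p' (by omega) (by omega)
    have := hupper q (by omega) (by omega)
    refine ⟨p + (f p' - f p), p', f p', f q - f p', ?_, ?_, ?_⟩
    · simp only [IsBox, OnAsc, isDot_iff, ← hf]
      refine ⟨by omega, by omega, fun s s0 s1 => ?_, fun hc => r6 ?_, fun s s0 s1 => ?_,
        fun hc => r5' hc.2.2⟩
      · exact ⟨by omega, by omega, by rw [r4 _ (by omega) (by omega)]; ring⟩
      · have := hc.2.2
        rw [show p + (f p' - f p) + (f q - f p') + 1 = q + 1 by omega] at this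
        omega
      · exact ⟨by omega, by omega, by rw [r4' _ (by omega) (by omega)]; ring⟩
    · simp only [BoxUnpierced, isDot_iff, ← hf]
      refine ⟨fun i i1 i2 hc => ?_, fun i i1 i2 hc => ?_⟩
      · rcases le_or_gt i q with hi | hi
        · have := r4 i (by omega) hi
          omega
        · exact (hclean i hi i2).1 hc.2.2
      · rcases lt_or_ge i p' with hi | hi
        · exact (hclean i (by omega) hi).2 (by omega)
        · have := r4' i hi (by omega)
          omega
    · refine strictlyInside_of_dot_notMem ?_ hby ?_ ?_
      · rintro ⟨i, j⟩ ⟨c1, c2, c3, c4⟩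
        dsimp only at *
        refine ⟨?_, ?_, ?_, ?_⟩ <;> dsimp only <;> omega
      · refine ⟨?_, ?_, ?_, ?_⟩ <;> dsimp only <;> omega
      · rintro ⟨c1, -⟩
        dsimp only at c1
        omega
end
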